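/- Let m ≥ 3 and let G be an m-free digraph obtained from a tournament by deleting t edges. Then there exists a vertex v in G with out-degree d^+(v) ≤ √(2t/(m-2)). -/

import Mathlib

/-- Out-degree of `v`: the number of out-neighbors. -/
noncomputable def outDeg {V : Type*} (Adj : V → V → Prop) (v : V) : ℕ :=
  {w | Adj v w}.ncard

/-- The set of vertices at directed distance exactly 2 from `v`. -/
def secondNbr {V : Type*} (Adj : V → V → Prop) (v : V) : Set V :=
  {w | w ≠ v ∧ ¬ Adj v w ∧ ∃ u, Adj v u ∧ Adj u w}

/-- `Adj` has a directed cycle of length `k`. -/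
def HasCycleOfLength {V : Type*} (Adj : V → V → Prop) (k : ℕ) : Prop :=
  ∃ c : Fin k → V, Function.Injective c ∧ ∀ i : Fin k, Adj (c i) (c ⟨(i.val + 1) % k, Nat.mod_lt _ i.pos⟩)

/-- `Adj` has no directed cycles. -/
def Acyclic {V : Type*} (Adj : V → V → Prop) : Prop :=
  ∀ k : ℕ, 1 ≤ k → ¬ HasCycleOfLength Adj k

/-- `Adj` is `m`-free: it has no directed cycle of length at most `m`. -/
def MFree {V : Type*} (Adj : V → V → Prop) (m : ℕ) : Prop :=
  ∀ k : ℕ, 1 ≤ k → k ≤ m → ¬ HasCycleOfLength Adj k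

/-- `T` is a tournament: irreflexive and exactly one arc between distinct vertices. -/
def IsTournament {V : Type*} (T : V → V → Prop) : Prop :=
  (∀ v, ¬ T v v) ∧ ∀ a b : V, a ≠ b → (T a b ↔ ¬ T b a)

/-- The number of arcs of `T` that are missing in `Adj`. -/
noncomputable def deletedCount {V : Type*} (T Adj : V → V → Prop) : ℕ :=
  {p : V × V | T p.1 p.2 ∧ ¬ Adj p.1 p.2}.ncard

/-- `WalkRel R n x y`: there is a walk with `n` steps from `x` to `y`. -/
def WalkRel {V : Type*} (R : V → V → Prop) : ℕ → V → V → Prop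
  | 0 => Eq
  | n + 1 => fun x y => ∃ z, WalkRel R n x z ∧ R z y

/-- `DistEq R n x y`: the directed distance from `x` to `y` is exactly `n`. -/
def DistEq {V : Type*} (R : V → V → Prop) (n : ℕ) (x y : V) : Prop :=
  WalkRel R n x y ∧ ∀ k < n, ¬ WalkRel R k x y

/-- There is no closed walk of positive length at most `m`. -/
def NoClosedWalk {V : Type*} (R : V → V → Prop) (m : ℕ) : Prop :=
  ∀ k, 1 ≤ k → k ≤ m → ∀ v, ¬ WalkRel R k v v

section Walks

variable {V : Type*} {R : V → V → Prop}

theorem walkRel_one {x y : V} : WalkRel R 1 x y ↔ R x y := by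
  simp [WalkRel]

theorem WalkRel.trans {a b : ℕ} {x y z : V} (h : WalkRel R a x y) (h' : WalkRel R b y z) :
    WalkRel R (a + b) x z := by
  induction b generalizing z with
  | zero => cases h'; exact h
  | succ b ih =>
    obtain ⟨w, hw, hwz⟩ := h'
    exact ⟨w, ih hw, hwz⟩

theorem WalkRel.flip {n : ℕ} {x y : V} (h : WalkRel R n x y) : WalkRel (flip R) n y x := by
  induction n generalizing y with
  | zero => exact h.symm
  | succ n ih =>
    obtain ⟨z, hz, hzy⟩ := h
    have h1 : WalkRel (_root_.flip R) 1 y z := walkRel_one.2 hzy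
    simpa [add_comm] using h1.trans (ih hz)

theorem walkRel_flip {n : ℕ} {x y : V} : WalkRel (flip R) n x y ↔ WalkRel R n y x :=
  ⟨fun h => h.flip, fun h => h.flip⟩

theorem distEq_flip {n : ℕ} {x y : V} : DistEq (flip R) n x y ↔ DistEq R n y x := by
  simp [DistEq, walkRel_flip]

theorem WalkRel.mono {R' : V → V → Prop} (hR : ∀ a b, R a b → R' a b) {n : ℕ} {x y : V}
    (h : WalkRel R n x y) : WalkRel R' n x y := by
  induction n generalizing y with
  | zero => exact h
  | succ n ih =>
    obtain ⟨z, hz, hzy⟩ := h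
    exact ⟨z, ih hz, hR _ _ hzy⟩

theorem DistEq.unique {a b : ℕ} {x y : V} (h : DistEq R a x y) (h' : DistEq R b x y) :
    a = b := by
  rcases lt_trichotomy a b with hab | hab | hab
  · exact absurd h.1 (h'.2 a hab)
  · exact hab
  · exact absurd h'.1 (h.2 b hab)

theorem NoClosedWalk.flip {m : ℕ} (h : NoClosedWalk R m) : NoClosedWalk (flip R) m :=
  fun k h1 h2 v hv => h k h1 h2 v hv.flip

theorem WalkRel.exists_seq {n : ℕ} {x y : V} (h : WalkRel R n x y) :
    ∃ c : ℕ → V, c 0 = x ∧ c n = y ∧ ∀ i < n, R (c i) (c (i + 1)) := by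
  induction n generalizing y with
  | zero => exact ⟨fun _ => x, rfl, h, by simp⟩
  | succ n ih =>
    obtain ⟨z, hz, hzy⟩ := h
    obtain ⟨c, h0, hn, hc⟩ := ih hz
    refine ⟨fun i => if i ≤ n then c i else y, by simp [h0], by simp, fun i hi => ?_⟩
    rcases Nat.lt_succ_iff_lt_or_eq.1 hi with hi | rfl
    · simpa [hi.le, Nat.succ_le_of_lt hi] using hc i hi
    · simpa [hn] using hzy

theorem walkRel_of_seq {c : ℕ → V} {i n : ℕ} (hc : ∀ j, i ≤ j → j < i + n → R (c j) (c (j + 1))) :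
    WalkRel R n (c i) (c (i + n)) := by
  induction n with
  | zero => rfl
  | succ n ih =>
    exact ⟨c (i + n), ih fun j h1 h2 => hc j h1 (by omega), hc _ (by omega) (by omega)⟩

/-- A shortest closed walk is a directed cycle. -/
theorem MFree.noClosedWalk {m : ℕ} (h : MFree R m) : NoClosedWalk R m := by
  intro k
  induction k using Nat.strong_induction_on with
  | _ k ih =>
    intro hk hkm v hv
    obtain ⟨c, h0, hn, hc⟩ := hv.exists_seq
    have hlt : ∀ i j : ℕ, i < j → j < k → c i ≠ c j := by
      intro i j hij hjk heq
      refine ih (j - i) (by omega) (by omega) (by omega) (c i) ?_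
      have := walkRel_of_seq (R := R) (c := c) (i := i) (n := j - i)
        fun l _ h2 => hc l (by omega)
      rwa [Nat.add_sub_cancel' hij.le, ← heq] at this
    refine h k hk hkm ⟨fun i => c i, fun i j hij => ?_, fun i => ?_⟩
    · rcases lt_trichotomy i j with hlt' | heq | hlt'
      · exact absurd hij (hlt i j hlt' j.2)
      · exact heq
      · exact absurd hij.symm (hlt j i hlt' i.2)
    · rcases Nat.lt_or_ge (i.val + 1) k with hi | hi
      · simpa [Nat.mod_eq_of_lt hi] using hc i i.2
      · have hik : i.val + 1 = k := by have := i.2; omega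
        have h1 := hc i i.2
        rw [hik, hn, ← h0] at h1
        simpa [hik] using h1

end Walks

open Classical in
/-- The number of pairs in `X × Y` satisfying `P`. -/
noncomputable def pairCount {V : Type*} (P : V → V → Prop) (X Y : Finset V) : ℕ :=
  ∑ x ∈ X, ∑ y ∈ Y, if P x y then 1 else 0

section PairCount

variable {V : Type*} {P Q : V → V → Prop} {X Y Z : Finset V}

theorem pairCount_flip : pairCount (flip P) X Y = pairCount P Y X := by
  unfold pairCount
  rw [Finset.sum_comm]
  rfl

theorem pairCount_mono (h : ∀ x ∈ X, ∀ y ∈ Y, P x y → Q x y) :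
    pairCount P X Y ≤ pairCount Q X Y := by
  classical
  unfold pairCount
  refine Finset.sum_le_sum fun x hx => Finset.sum_le_sum fun y hy => ?_
  have := h x hx y hy
  split_ifs <;> first | omega | tauto

theorem pairCount_eq_zero (h : ∀ x ∈ X, ∀ y ∈ Y, ¬ P x y) : pairCount P X Y = 0 := by
  unfold pairCount
  exact Finset.sum_eq_zero fun x hx => Finset.sum_eq_zero fun y hy => if_neg (h x hx y hy)

open Classical in
theorem pairCount_eq_card :
    pairCount P X Y = ((X ×ˢ Y).filter fun p => P p.1 p.2).card := by
  rw [Finset.card_filter, Finset.sum_product]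
  rfl

open Classical in
theorem pairCount_split {S : Finset V} (h : X ⊆ S) :
    pairCount P S S = pairCount P X X + pairCount P X (S \ X) + pairCount P (S \ X) X +
      pairCount P (S \ X) (S \ X) := by
  have hl : ∀ f : V → ℕ, ∑ x ∈ S, f x = ∑ x ∈ X, f x + ∑ x ∈ S \ X, f x := fun f => by
    rw [add_comm, Finset.sum_sdiff h]
  unfold pairCount
  simp only [hl, Finset.sum_add_distrib]
  omega

end PairCount

/-- Neither `R x y` nor `R y x`. -/
def NonAdj {V : Type*} (R : V → V → Prop) (x y : V) : Prop := ¬ R x y ∧ ¬ R y x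

section Cut

variable {V : Type*}

open Classical in
/-- The out-ball of radius `i` around `v` inside `S`. -/
noncomputable def outBall (R : V → V → Prop) (S : Finset V) (i : ℕ) (v : V) : Finset V :=
  {x ∈ S | ∃ k ≤ i, WalkRel R k v x}

theorem mem_outBall {R : V → V → Prop} {S : Finset V} {i : ℕ} {v x : V} :
    x ∈ outBall R S i v ↔ x ∈ S ∧ ∃ k ≤ i, WalkRel R k v x := by
  simp [outBall]

variable [Fintype V]

open Classical in
/-- Triples `(v, x, y)` where `x → y` is an edge leaving the out-ball of radius `k` around `v`. -/
noncomputable def leaving (R : V → V → Prop) (k : ℕ) : Finset (V × V × V) :=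
  {p | DistEq R k p.1 p.2.1 ∧ R p.2.1 p.2.2 ∧ DistEq R (k + 1) p.1 p.2.2}

theorem mem_leaving {R : V → V → Prop} {k : ℕ} {v x y : V} :
    (v, x, y) ∈ leaving R k ↔ DistEq R k v x ∧ R x y ∧ DistEq R (k + 1) v y := by
  simp [leaving]

open Classical in
theorem sum_pairCount_outBall_le {R : V → V → Prop} {S : Finset V} {i : ℕ} :
    ∑ v ∈ S, pairCount R (outBall R S i v) (S \ outBall R S i v) ≤ (leaving R i).card := by
  simp only [pairCount_eq_card]
  rw [← Finset.card_sigma]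
  refine Finset.card_le_card_of_injOn (fun p => (p.1, p.2)) ?_ ?_
  · rintro ⟨v, x, y⟩ h
    simp only [Finset.coe_sigma, Set.mem_sigma_iff, Finset.mem_coe, Finset.mem_filter,
      Finset.mem_product, mem_outBall, Finset.mem_sdiff] at h
    obtain ⟨hv, ⟨⟨hx, k, hk, hw⟩, hy, hny⟩, hR⟩ := h
    have hy' : ∀ l ≤ i, ¬ WalkRel R l v y := fun l hl hl' => hny ⟨hy, l, hl, hl'⟩
    have hx' : ∀ l < i, ¬ WalkRel R l v x := fun l hl hl' => hy' (l + 1) hl ⟨x, hl', hR⟩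
    have hki : k = i := by
      by_contra hne
      exact hx' k (by omega) hw
    subst hki
    exact mem_leaving.2 ⟨⟨hw, hx'⟩, hR, ⟨x, hw, hR⟩, fun l hl => hy' l (by omega)⟩
  · rintro ⟨v, x, y⟩ - ⟨v', x', y'⟩ - h
    simp only [Prod.mk.injEq] at h
    obtain ⟨rfl, rfl, rfl⟩ := h
    rfl

open Classical in
theorem leaving_sum_le_sum_pairCount {R : V → V → Prop} {S : Finset V}
    (hS : ∀ a b, R a b → a ∈ S ∧ b ∈ S) {q i : ℕ} (hR : NoClosedWalk R (q + 2))
    (hi : 1 ≤ i) (hiq : i ≤ q) :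
    ∑ j ∈ Finset.Icc 1 (q + 1 - i), (leaving R j).card +
        ∑ p ∈ Finset.Icc 2 i, (leaving (flip R) p).card ≤
      ∑ v ∈ S, pairCount (NonAdj R) (outBall R S i v) (S \ outBall R S i v) := by
  simp only [pairCount_eq_card]
  rw [← Finset.card_sigma, ← Finset.card_sigma, ← Finset.card_sigma, ← Finset.card_disjSum]
  refine Finset.card_le_card_of_injOn
    (Sum.elim (fun p => ⟨p.2.2.1, (p.2.2.2, p.2.1)⟩) (fun p => ⟨p.2.2.1, (p.2.1, p.2.2.2)⟩)) ?_ ?_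
  · rintro (⟨j, u, w, y⟩ | ⟨p, y, w, u⟩) h
    · simp only [Finset.mem_coe, Finset.inl_mem_disjSum, Finset.mem_sigma, Finset.mem_Icc,
        mem_leaving] at h
      obtain ⟨⟨h1, h2⟩, hd, he, hd'⟩ := h
      have hu : u ∈ S := by
        obtain ⟨j, rfl⟩ := Nat.exists_eq_add_of_le h1
        have := (walkRel_flip (R := R)).2 hd.1
        rw [add_comm] at this
        obtain ⟨z, -, hz⟩ := this
        exact (hS _ _ hz).1
      simp only [Sum.elim_inl, Finset.coe_sigma, Set.mem_sigma_iff, Finset.mem_coe,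
        Finset.mem_filter, Finset.mem_product, mem_outBall, Finset.mem_sdiff]
      refine ⟨(hS _ _ he).1, ⟨⟨(hS _ _ he).2, 1, hi, walkRel_one.2 he⟩, hu, ?_⟩, ?_, ?_⟩
      · rintro ⟨-, k, hk, hw⟩
        exact hR (k + j) (by omega) (by omega) w (hw.trans hd.1)
      · intro hyu
        exact hR (j + 1 + 1) (by omega) (by omega) u ⟨y, hd'.1, hyu⟩
      · intro huy
        exact hd'.2 1 (by omega) (walkRel_one.2 huy)
    · simp only [Finset.mem_coe, Finset.inr_mem_disjSum, Finset.mem_sigma, Finset.mem_Icc,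
        mem_leaving, distEq_flip] at h
      obtain ⟨⟨h1, h2⟩, hd, he, hd'⟩ := h
      have he : R u w := he
      have hy : y ∈ S := by
        obtain ⟨z, -, hz⟩ := hd'.1
        exact (hS _ _ hz).2
      simp only [Sum.elim_inr, Finset.coe_sigma, Set.mem_sigma_iff, Finset.mem_coe,
        Finset.mem_filter, Finset.mem_product, mem_outBall, Finset.mem_sdiff]
      refine ⟨(hS _ _ he).2, ⟨⟨hy, p, h2, hd.1⟩, (hS _ _ he).1, ?_⟩, ?_, ?_⟩
      · rintro ⟨-, k, hk, hw⟩
        exact hR (k + 1) (by omega) (by omega) w ⟨u, hw, he⟩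
      · intro hyu
        exact hR (p + 1 + 1) (by omega) (by omega) u ⟨y, hd'.1, hyu⟩
      · intro huy
        exact hd'.2 1 (by omega) (walkRel_one.2 huy)
  · rintro (⟨j, u, w, y⟩ | ⟨p, y, w, u⟩) h (⟨j', u', w', y'⟩ | ⟨p', y', w', u'⟩) h' heq <;>
    simp only [Finset.mem_coe, Finset.inl_mem_disjSum, Finset.inr_mem_disjSum, Finset.mem_sigma,
      Finset.mem_Icc, mem_leaving, distEq_flip] at h h' <;>
    simp only [Sum.elim_inl, Sum.elim_inr, Sigma.mk.injEq, heq_eq_eq, Prod.mk.injEq] at heq <;>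
    obtain ⟨rfl, rfl, rfl⟩ := heq
    · obtain rfl := h.2.1.unique h'.2.1
      rfl
    · exact absurd (walkRel_one.2 h.2.2.1) (h'.2.1.2 1 (by omega))
    · exact absurd (walkRel_one.2 h'.2.2.1) (h.2.1.2 1 (by omega))
    · obtain rfl := h.2.1.unique h'.2.1
      rfl

open Classical in
theorem exists_sparse_outBall {R : V → V → Prop} {S : Finset V} (hne : S.Nonempty)
    (hS : ∀ a b, R a b → a ∈ S ∧ b ∈ S) {q i : ℕ} (hR : NoClosedWalk R (q + 2))
    (hi : i ∈ Finset.Icc 1 q)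
    (h₁ : ∀ j ∈ Finset.Icc 1 q, (leaving R i).card ≤ (leaving R j).card)
    (h₂ : ∀ j ∈ Finset.Icc 1 q, (leaving R i).card ≤ (leaving (flip R) j).card) :
    ∃ v ∈ S, q * pairCount R (outBall R S i v) (S \ outBall R S i v) ≤
      pairCount (NonAdj R) (outBall R S i v) (S \ outBall R S i v) := by
  rw [Finset.mem_Icc] at hi
  refine Finset.exists_le_of_sum_le hne ?_
  rw [← Finset.mul_sum]
  refine le_trans ?_ (leaving_sum_le_sum_pairCount hS hR hi.1 hi.2)
  have e₁ := Finset.card_nsmul_le_sum (Finset.Icc 1 (q + 1 - i)) (fun j => (leaving R j).card)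
    (leaving R i).card fun j hj => h₁ j (by rw [Finset.mem_Icc] at *; omega)
  have e₂ := Finset.card_nsmul_le_sum (Finset.Icc 2 i) (fun j => (leaving (flip R) j).card)
    (leaving R i).card fun j hj => h₂ j (by rw [Finset.mem_Icc] at *; omega)
  rw [Nat.card_Icc, smul_eq_mul] at e₁ e₂
  have hq : q = (q + 1 - i + 1 - 1) + (i + 1 - 2) := by omega
  calc _ ≤ q * (leaving R i).card := Nat.mul_le_mul_left _ sum_pairCount_outBall_le
    _ = (q + 1 - i + 1 - 1) * (leaving R i).card + (i + 1 - 2) * (leaving R i).card := by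
      rw [← add_mul, ← hq]
    _ ≤ _ := add_le_add e₁ e₂

open Classical in
/-- The case of a sparse cut in which out-balls do at least as well as in-balls. -/
theorem exists_sparse_cut_of_min {R : V → V → Prop} {S : Finset V} (hne : S.Nonempty)
    (hS : ∀ a b, R a b → a ∈ S ∧ b ∈ S) {q i : ℕ} (hR : NoClosedWalk R (q + 2))
    (hsource : ∀ v ∈ S, ∃ u, R u v) (hi : i ∈ Finset.Icc 1 q)
    (h₁ : ∀ j ∈ Finset.Icc 1 q, (leaving R i).card ≤ (leaving R j).card)
    (h₂ : ∀ j ∈ Finset.Icc 1 q, (leaving R i).card ≤ (leaving (flip R) j).card) :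
    ∃ X ⊆ S, X.Nonempty ∧ (S \ X).Nonempty ∧
      q * pairCount R X (S \ X) ≤ pairCount (NonAdj R) X (S \ X) := by
  obtain ⟨v, hv, h⟩ := exists_sparse_outBall hne hS hR hi h₁ h₂
  rw [Finset.mem_Icc] at hi
  refine ⟨outBall R S i v, Finset.filter_subset _ _, ⟨v, mem_outBall.2 ⟨hv, 0, by omega, rfl⟩⟩,
    ?_, h⟩
  obtain ⟨u, hu⟩ := hsource v hv
  refine ⟨u, Finset.mem_sdiff.2 ⟨(hS _ _ hu).1, fun hmem => ?_⟩⟩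
  obtain ⟨-, k, hk, hw⟩ := mem_outBall.1 hmem
  exact hR (k + 1) (by omega) (by omega) v ⟨u, hw, hu⟩

open Classical in
theorem exists_sparse_cut {R : V → V → Prop} {S : Finset V} (hcard : 2 ≤ S.card)
    (hS : ∀ a b, R a b → a ∈ S ∧ b ∈ S) {q : ℕ} (hq : 1 ≤ q) (hR : NoClosedWalk R (q + 2)) :
    ∃ X ⊆ S, X.Nonempty ∧ (S \ X).Nonempty ∧
      q * pairCount R X (S \ X) ≤ pairCount (NonAdj R) X (S \ X) := by
  have hne : S.Nonempty := Finset.card_pos.1 (by omega)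
  by_cases hsource : ∀ v ∈ S, ∃ u, R u v
  swap
  · push Not at hsource
    obtain ⟨s, hs, hs'⟩ := hsource
    have hcompl : S \ S.erase s = {s} := by ext x; simp; grind
    refine ⟨S.erase s, Finset.erase_subset _ _, ?_, ?_, ?_⟩
    · rw [← Finset.card_pos, Finset.card_erase_of_mem hs]; omega
    · simp [hcompl]
    · rw [pairCount_eq_zero (P := R)]
      · simp
      · intro x _ y hy
        rw [hcompl, Finset.mem_singleton] at hy
        exact hy ▸ hs' x
  by_cases hsink : ∀ v ∈ S, ∃ u, R v u
  swap
  · push Not at hsink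
    obtain ⟨s, hs, hs'⟩ := hsink
    refine ⟨{s}, by simpa using hs, by simp, ?_, ?_⟩
    · rw [← Finset.card_pos, Finset.card_sdiff_of_subset (by simpa using hs),
        Finset.card_singleton]
      omega
    · rw [pairCount_eq_zero (P := R)]
      · simp
      · intro x hx y _
        rw [Finset.mem_singleton] at hx
        exact hx ▸ hs' y
  have hIcc : (Finset.Icc 1 q).Nonempty := Finset.nonempty_Icc.2 hq
  obtain ⟨i, hi, hmin⟩ := Finset.exists_min_image _ (fun j => (leaving R j).card) hIcc
  obtain ⟨i', hi', hmin'⟩ := Finset.exists_min_image _ (fun j => (leaving (flip R) j).card) hIcc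
  rcases le_total (leaving R i).card (leaving (flip R) i').card with h | h
  · exact exists_sparse_cut_of_min hne hS hR hsource hi hmin fun j hj => h.trans (hmin' j hj)
  · obtain ⟨X, hX, h₁, h₂, h₃⟩ := exists_sparse_cut_of_min (R := flip R) hne
      (fun a b hab => (hS b a hab).symm) hR.flip hsink hi' hmin' fun j hj => h.trans (hmin j hj)
    refine ⟨S \ X, Finset.sdiff_subset, h₂, by rwa [Finset.sdiff_sdiff_eq_self hX], ?_⟩
    rw [Finset.sdiff_sdiff_eq_self hX]
    rw [pairCount_flip, ← pairCount_flip (P := NonAdj (flip R)) (X := S \ X)] at h₃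
    exact h₃

end Cut

open Classical in
/-- A digraph without closed walks of length at most `q + 2` has a vertex ordering whose number of
backward edges is at most the number of nonadjacent pairs divided by `q`. -/
theorem exists_ordering {V : Type*} [Fintype V] {A : V → V → Prop} {q : ℕ} (hq : 1 ≤ q)
    (hA : NoClosedWalk A (q + 2)) (S : Finset V) :
    ∃ r : V → ℕ, S.image r = Finset.range S.card ∧
      2 * (q * pairCount (fun x y => A x y ∧ r x < r y) S S) ≤
        pairCount (fun x y => x ≠ y ∧ NonAdj A x y) S S := by
  induction S using Finset.strongInduction with
  | _ S ih =>
    rcases Nat.lt_or_ge S.card 2 with hcard | hcard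
    · refine ⟨fun _ => 0, ?_, ?_⟩
      · rcases S.eq_empty_or_nonempty with rfl | hne
        · simp
        · have : S.card = 1 := by have := hne.card_pos; omega
          rw [this, Finset.image_const hne]; rfl
      · rw [pairCount_eq_zero] <;> simp
    set R : V → V → Prop := fun a b => a ∈ S ∧ b ∈ S ∧ A a b
    have hR : NoClosedWalk R (q + 2) := fun k h1 h2 v hv =>
      hA k h1 h2 v (hv.mono fun a b h => h.2.2)
    obtain ⟨X, hXS, hX, hY, hcut⟩ := exists_sparse_cut (R := R) hcard
      (fun a b h => ⟨h.1, h.2.1⟩) hq hR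
    set Y := S \ X with hYdef
    have hYS : Y ⊆ S := Finset.sdiff_subset
    have hdisj : Disjoint X Y := Finset.disjoint_sdiff
    have hXY : X ∪ Y = S := Finset.union_sdiff_of_subset hXS
    have hcardS : X.card + Y.card = S.card := by rw [← hXY, Finset.card_union_of_disjoint hdisj]
    obtain ⟨r₁, hr₁, hβ₁⟩ := ih X (Finset.ssubset_iff_subset_ne.2
      ⟨hXS, by rintro rfl; simp [Y] at hY⟩)
    obtain ⟨r₂, hr₂, hβ₂⟩ := ih Y (Finset.ssubset_iff_subset_ne.2
      ⟨hYS, by intro h; rw [h] at hcardS; have := hX.card_pos; omega⟩)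
    set r : V → ℕ := fun x => if x ∈ X then r₁ x else r₂ x + X.card with hr
    have hrX : ∀ x ∈ X, r x = r₁ x := fun x hx => by simp [hr, hx]
    have hrY : ∀ x ∈ Y, r x = r₂ x + X.card := fun x hx => by
      simp [hr, Finset.disjoint_right.1 hdisj hx]
    have hlt : ∀ x ∈ X, r x < X.card := fun x hx => by
      rw [hrX x hx, ← Finset.mem_range, ← hr₁]
      exact Finset.mem_image_of_mem _ hx
    refine ⟨r, ?_, ?_⟩
    · have e₁ : X.image r = Finset.range X.card := by
        rw [← hr₁]; exact Finset.image_congr hrX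
      have e₂ : Y.image r = (Finset.range Y.card).image (· + X.card) := by
        rw [← hr₂, Finset.image_image]; exact Finset.image_congr hrY
      rw [← hXY, Finset.image_union, e₁, e₂, hXY, ← hcardS]
      ext n
      simp only [Finset.mem_union, Finset.mem_range, Finset.mem_image]
      constructor
      · rintro (h | ⟨a, h, rfl⟩) <;> omega
      · intro h
        rcases Nat.lt_or_ge n X.card with h' | h'
        · exact Or.inl h'
        · exact Or.inr ⟨n - X.card, by omega, by omega⟩
    · rw [pairCount_split hXS, pairCount_split hXS, ← hYdef]
      have b₁ : pairCount (fun x y => A x y ∧ r x < r y) X X ≤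
          pairCount (fun x y => A x y ∧ r₁ x < r₁ y) X X :=
        pairCount_mono fun x hx y hy h => by rwa [hrX x hx, hrX y hy] at h
      have b₂ : pairCount (fun x y => A x y ∧ r x < r y) Y Y ≤
          pairCount (fun x y => A x y ∧ r₂ x < r₂ y) Y Y :=
        pairCount_mono fun x hx y hy h => by
          rw [hrY x hx, hrY y hy] at h
          exact ⟨h.1, by omega⟩
      have b₃ : pairCount (fun x y => A x y ∧ r x < r y) X Y ≤ pairCount R X Y :=
        pairCount_mono fun x hx y hy h => ⟨hXS hx, hYS hy, h.1⟩
      have b₄ : pairCount (fun x y => A x y ∧ r x < r y) Y X = 0 :=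
        pairCount_eq_zero fun x hx y hy h => by
          have := hlt y hy
          have := hrY x hx
          omega
      have c₁ : pairCount (NonAdj R) X Y ≤ pairCount (fun x y => x ≠ y ∧ NonAdj A x y) X Y :=
        pairCount_mono fun x hx y hy h =>
          ⟨fun hxy => Finset.disjoint_left.1 hdisj hx (hxy ▸ hy),
            fun h' => h.1 ⟨hXS hx, hYS hy, h'⟩, fun h' => h.2 ⟨hYS hy, hXS hx, h'⟩⟩
      have c₂ : pairCount (fun x y => x ≠ y ∧ NonAdj A x y) X Y ≤
          pairCount (fun x y => x ≠ y ∧ NonAdj A x y) Y X := by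
        rw [← pairCount_flip]
        exact pairCount_mono fun x _ y _ h => ⟨h.1.symm, h.2.2, h.2.1⟩
      have d₁ := Nat.mul_le_mul_left q b₁
      have d₂ := Nat.mul_le_mul_left q b₂
      have d₃ := Nat.mul_le_mul_left q b₃
      simp only [b₄, mul_add]
      omega

open Classical in
/-- If all out-degrees are at least `d`, every ordering has at least `d (d + 1) / 2` backward
edges. -/
theorem sq_le_two_mul_backward {V : Type*} [Fintype V] {A : V → V → Prop} {d : ℕ} [Nonempty V]
    (hirr : ∀ v, ¬ A v v) (hd : ∀ v, d ≤ outDeg A v) {r : V → ℕ}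
    (hr : Finset.univ.image r = Finset.range (Finset.univ : Finset V).card) :
    d ^ 2 ≤ 2 * pairCount (fun x y => A x y ∧ r x < r y) Finset.univ Finset.univ := by
  have hinj : Function.Injective r := by
    have := Finset.card_image_iff.1 (by rw [hr, Finset.card_range] :
      (Finset.univ.image r).card = (Finset.univ : Finset V).card)
    simpa using this
  have hout : ∀ v, outDeg A v = (Finset.univ.filter (A v)).card := fun v => by
    rw [outDeg, ← Set.ncard_coe_finset]; simp
  have hdcard : d ≤ (Finset.univ : Finset V).card := by
    obtain ⟨v⟩ := ‹Nonempty V›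
    exact (hd v).trans ((hout v).trans_le (Finset.card_filter_le _ _))
  have hback : ∀ x, d - r x ≤ ∑ y : V, if A x y ∧ r x < r y then 1 else 0 := by
    intro x
    rw [← Finset.card_filter, Nat.sub_le_iff_le_add]
    have hsmall : (Finset.univ.filter fun y => r y < r x).card ≤ r x := by
      calc _ ≤ (Finset.range (r x)).card := Finset.card_le_card_of_injOn r
            (fun y hy => by simpa using hy) hinj.injOn
        _ = r x := Finset.card_range _
    have hsub : Finset.univ.filter (A x) ⊆
        (Finset.univ.filter fun y => A x y ∧ r x < r y) ∪ Finset.univ.filter fun y => r y < r x := by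
      intro y hy
      simp only [Finset.mem_union, Finset.mem_filter, Finset.mem_univ, true_and] at hy ⊢
      have hne : r x ≠ r y := fun h => hirr x (by rwa [← hinj h] at hy)
      rcases hne.lt_or_gt with h | h
      · exact Or.inl ⟨hy, h⟩
      · exact Or.inr h
    have h₁ := (Finset.card_le_card hsub).trans (Finset.card_union_le _ _)
    have h₂ := hd x
    rw [hout] at h₂
    omega
  have hsum : ∑ j ∈ Finset.range d, (d - j) ≤
      pairCount (fun x y => A x y ∧ r x < r y) Finset.univ Finset.univ := by
    calc _ ≤ ∑ j ∈ Finset.range (Finset.univ : Finset V).card, (d - j) :=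
          Finset.sum_le_sum_of_subset (Finset.range_subset_range.2 hdcard)
      _ = ∑ x, (d - r x) := by rw [← hr, Finset.sum_image hinj.injOn]
      _ ≤ _ := by
        unfold pairCount
        exact Finset.sum_le_sum fun x _ => (hback x).trans_eq (by congr!)
  have hgauss : ∀ n : ℕ, n ^ 2 ≤ 2 * ∑ j ∈ Finset.range n, (n - j) := fun n => by
    induction n with
    | zero => simp
    | succ n ih =>
      rw [Finset.sum_range_succ']
      simp only [Nat.add_sub_add_right, Nat.sub_zero]
      linarith
  exact (hgauss d).trans (Nat.mul_le_mul_left 2 hsum)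

open Classical in
theorem pairCount_nonAdj_le {V : Type*} [Fintype V] {T A : V → V → Prop} (hT : IsTournament T) :
    pairCount (fun x y => x ≠ y ∧ NonAdj A x y) Finset.univ Finset.univ ≤
      2 * deletedCount T A := by
  have hle : pairCount (fun x y => x ≠ y ∧ NonAdj A x y) Finset.univ Finset.univ ≤
      pairCount (fun x y => T x y ∧ ¬ A x y) Finset.univ Finset.univ +
        pairCount (flip fun x y => T x y ∧ ¬ A x y) Finset.univ Finset.univ := by
    unfold pairCount
    simp only [← Finset.sum_add_distrib]
    refine Finset.sum_le_sum fun x _ => Finset.sum_le_sum fun y _ => ?_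
    by_cases h : x ≠ y ∧ NonAdj A x y
    · have := hT.2 x y h.1
      have h₁ := h.2.1
      have h₂ := h.2.2
      by_cases hxy : T x y
      · simp [hxy, h₁]
        split_ifs <;> omega
      · have hyx : T y x := by tauto
        simp [flip, hyx, h₂]
        split_ifs <;> omega
    · simp [h]
  have hcount : deletedCount T A =
      pairCount (fun x y => T x y ∧ ¬ A x y) Finset.univ Finset.univ := by
    rw [pairCount_eq_card, deletedCount, ← Set.ncard_coe_finset]
    simp
  rw [pairCount_flip, ← hcount] at hle
  omega

theorem small_outdeg_vertex {V : Type*} [Fintype V] [Nonempty V]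
    (m : ℕ) (hm : 3 ≤ m)
    (T Adj : V → V → Prop) (hT : IsTournament T)
    (hsub : ∀ a b, Adj a b → T a b)
    (t : ℕ) (hcount : deletedCount T Adj = t)
    (hfree : MFree Adj m) :
    ∃ v : V, (outDeg Adj v : ℝ) ≤ Real.sqrt (2 * (t : ℝ) / ((m : ℝ) - 2)) := by
  obtain ⟨q, rfl⟩ := Nat.exists_eq_add_of_le' (show 2 ≤ m by omega)
  have hq : 1 ≤ q := by omega
  obtain ⟨v, hv⟩ := Finite.exists_min (outDeg Adj)
  obtain ⟨r, hr, hβ⟩ := exists_ordering hq hfree.noClosedWalk Finset.univ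
  have hback := sq_le_two_mul_backward (fun w h => hT.1 w (hsub w w h)) hv hr
  have hmissing := pairCount_nonAdj_le (A := Adj) hT
  rw [hcount] at hmissing
  have hnat : outDeg Adj v ^ 2 * q ≤ 2 * t := by
    have := Nat.mul_le_mul_right q hback
    linarith
  refine ⟨v, Real.le_sqrt_of_sq_le ?_⟩
  have hq' : (0 : ℝ) < q := by exact_mod_cast hq
  rw [Nat.cast_add, Nat.cast_ofNat, add_sub_cancel_right, le_div_iff₀ hq']
  exact_mod_cast hnat
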